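/- Direct bound for the average distortion class: R_a(D|E) ≤ min_{V ∈ 𝒱(E,D)} I(P_X, V), where I(P_X,V) = I(U;X) is the mutual information between the source letter X ~ P_X and the test-channel output U ~ V(·|X). -/

import Mathlib

open scoped BigOperators

noncomputable section

namespace UWZ

/-- real-valued indicator of a proposition. -/
def ind (p : Prop) : ℝ := @ite ℝ p (Classical.propDecidable p) 1 0

/-- `P` is a probability distribution on the finite type `A`. -/
def IsDist {A : Type*} [Fintype A] (P : A → ℝ) : Prop :=
  (∀ a, 0 ≤ P a) ∧ ∑ a, P a = 1

/-- `W` is a channel from `A` to `B`. -/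
def IsChannel {A B : Type*} [Fintype A] [Fintype B] (W : A → B → ℝ) : Prop :=
  ∀ a, IsDist (W a)

/-- the `n`-fold i.i.d. extension of `P`. -/
def iid {A : Type*} (P : A → ℝ) (n : ℕ) (xs : Fin n → A) : ℝ := ∏ t, P (xs t)

/-- the memoryless (`n`-fold i.i.d.) extension of a channel. -/
def memoryless {A B : Type*} (W : A → B → ℝ) (n : ℕ)
    (xs : Fin n → A) (ys : Fin n → B) : ℝ :=
  ∏ t, W (xs t) (ys t)

/-- the additive (per-letter, normalized) extension of a distortion measure. -/
def dseq {A B : Type*} (d : A → B → ℝ) (n : ℕ) (xs : Fin n → A) (ys : Fin n → B) : ℝ :=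
  (∑ t, d (xs t) (ys t)) / n

/-- Shannon entropy (in bits). -/
def ent {A : Type*} [Fintype A] (P : A → ℝ) : ℝ := -∑ a, P a * Real.logb 2 (P a)

/-- mutual information of a joint distribution on `A × B` (in bits). -/
def mutInf {A B : Type*} [Fintype A] [Fintype B] (J : A × B → ℝ) : ℝ :=
  ent (fun a => ∑ b, J (a, b)) + ent (fun b => ∑ a, J (a, b)) - ent J

section WZ

variable {X Y Xh : Type*} [Fintype X] [Fintype Y] [Fintype Xh] [DecidableEq Y]

/-- expected per-letter side-information distortion `e(P,W)` of channel `W`. -/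
def eDist (P : X → ℝ) (e : X → Y → ℝ) (W : X → Y → ℝ) : ℝ :=
  ∑ x, ∑ y, P x * W x y * e x y

/-- the class `𝒲₁(E)` of single-letter channels. -/
def W1 (P : X → ℝ) (e : X → Y → ℝ) (E : ℝ) : Set (X → Y → ℝ) :=
  {W | IsChannel W ∧ eDist P e W ≤ E}

/-- `d(V,W)`: expected reproduction distortion for a test channel `V` whose output
alphabet `𝒰` is the set of functions from `Y` to `Xh`. -/
def dVW (P : X → ℝ) (d : X → Xh → ℝ) (V : X → (Y → Xh) → ℝ) (W : X → Y → ℝ) : ℝ :=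
  ∑ u : Y → Xh, ∑ x, ∑ y, P x * V x u * W x y * d x (u y)

/-- `φ(V,W) = I(U;X) − I(U;Y)` under the joint law `P_X(x)V(u|x)W(y|x)`. -/
def phi (P : X → ℝ) (V : X → (Y → Xh) → ℝ) (W : X → Y → ℝ) : ℝ :=
  mutInf (fun p : (Y → Xh) × X => P p.2 * V p.2 p.1) -
    mutInf (fun p : (Y → Xh) × Y => ∑ x, P x * V x p.1 * W x p.2)

/-- `𝒱(W,D)`. -/
def Vset (P : X → ℝ) (d : X → Xh → ℝ) (W : X → Y → ℝ) (D : ℝ) :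
    Set (X → (Y → Xh) → ℝ) :=
  {V | IsChannel V ∧ dVW P d V W ≤ D}

/-- `𝒱(E,D)`. -/
def Vrob (P : X → ℝ) (e : X → Y → ℝ) (d : X → Xh → ℝ) (E D : ℝ) :
    Set (X → (Y → Xh) → ℝ) :=
  {V | IsChannel V ∧ ∀ W ∈ W1 P e E, dVW P d V W ≤ D}

/-- the Wyner–Ziv rate-distortion function `R_WZ(D|W)`. -/
def RWZ (P : X → ℝ) (d : X → Xh → ℝ) (D : ℝ) (W : X → Y → ℝ) : ℝ :=
  sInf ((fun V => phi P V W) '' Vset P d W D)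

/-- the pseudo rate-distortion function `R̃_WZ(D|W,E)`. -/
def RWZt (P : X → ℝ) (e : X → Y → ℝ) (d : X → Xh → ℝ) (D E : ℝ) (W : X → Y → ℝ) : ℝ :=
  sInf ((fun V => phi P V W) '' Vrob P e d E D)

end WZ

/-- a (possibly stochastic) Wyner–Ziv code of blocklength `n`:
a stochastic encoder `enc : 𝒳ⁿ → ℳ` and a decoder `dec : ℳ × 𝒴ⁿ → 𝒳̂ⁿ`. -/
structure Code (X Y Xh : Type*) [Fintype X] (n : ℕ) where
  M : ℕ
  Mpos : 0 < M
  enc : (Fin n → X) → Fin M → ℝ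
  enc_channel : IsChannel enc
  dec : Fin M → (Fin n → Y) → Fin n → Xh

section Codes

variable {X Y Xh : Type*} [Fintype X] [Fintype Y] [Fintype Xh]

/-- expected reproduction distortion of a code over the channel `Wn`. -/
def Code.expDist {n : ℕ} (C : Code X Y Xh n) (P : X → ℝ) (d : X → Xh → ℝ)
    (Wn : (Fin n → X) → (Fin n → Y) → ℝ) : ℝ :=
  ∑ xs, ∑ ys, ∑ m, iid P n xs * Wn xs ys * C.enc xs m * dseq d n xs (C.dec m ys)

/-- probability that the reproduction distortion of a code exceeds `D`, over channel `Wn`. -/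
def Code.excessProb {n : ℕ} (C : Code X Y Xh n) (P : X → ℝ) (d : X → Xh → ℝ)
    (Wn : (Fin n → X) → (Fin n → Y) → ℝ) (D : ℝ) : ℝ :=
  ∑ xs, ∑ ys, ∑ m, iid P n xs * Wn xs ys * C.enc xs m * ind (D < dseq d n xs (C.dec m ys))

/-- a sequence of channels from `X`-sequences to `Y`-sequences. -/
abbrev ChannelSeq (X Y : Type*) := ∀ n : ℕ, (Fin n → X) → (Fin n → Y) → ℝ

/-- probability that the side-information distortion exceeds `E`. -/
def excessSideProb (P : X → ℝ) (e : X → Y → ℝ) {n : ℕ}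
    (Wn : (Fin n → X) → (Fin n → Y) → ℝ) (E : ℝ) : ℝ :=
  ∑ xs, ∑ ys, iid P n xs * Wn xs ys * ind (E < dseq e n xs ys)

/-- expected side-information distortion at blocklength `n`. -/
def avgSideDist (P : X → ℝ) (e : X → Y → ℝ) {n : ℕ}
    (Wn : (Fin n → X) → (Fin n → Y) → ℝ) : ℝ :=
  ∑ xs, ∑ ys, iid P n xs * Wn xs ys * dseq e n xs ys

/-- the maximum distortion constrained class `𝒲_m(E)`. -/
def MaxClass (P : X → ℝ) (e : X → Y → ℝ) (E : ℝ) : Set (ChannelSeq X Y) :=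
  {Wseq | (∀ n, IsChannel (Wseq n)) ∧
    ∀ δ > (0:ℝ), ∃ n0 : ℕ, ∀ n ≥ n0, excessSideProb P e (Wseq n) E ≤ δ}

/-- the average distortion constrained class `𝒲_a(E)`. -/
def AvgClass (P : X → ℝ) (e : X → Y → ℝ) (E : ℝ) : Set (ChannelSeq X Y) :=
  {Wseq | (∀ n, IsChannel (Wseq n)) ∧ ∀ n, 1 ≤ n → avgSideDist P e (Wseq n) ≤ E}

/-- `R` is an achievable rate at distortion level `D`, universally for the class `WC`
of channel sequences. -/
def Achievable (P : X → ℝ) (d : X → Xh → ℝ) (WC : Set (ChannelSeq X Y)) (D R : ℝ) : Prop :=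
  ∀ ε > (0:ℝ), ∃ n0 : ℕ, ∃ C : ∀ n, Code X Y Xh n, ∀ n ≥ n0,
    Real.logb 2 ((C n).M : ℝ) / (n : ℝ) ≤ R + ε ∧
    ∀ Wseq ∈ WC, (C n).expDist P d (Wseq n) ≤ D + ε

/-- the rate-distortion function `R_m(D|E)` of the maximum distortion constrained class. -/
def Rm (P : X → ℝ) (e : X → Y → ℝ) (d : X → Xh → ℝ) (D E : ℝ) : ℝ :=
  sInf {R | Achievable P d (MaxClass P e E) D R}

/-- the rate-distortion function `R_a(D|E)` of the average distortion constrained class. -/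
def Ra (P : X → ℝ) (e : X → Y → ℝ) (d : X → Xh → ℝ) (D E : ℝ) : ℝ :=
  sInf {R | Achievable P d (AvgClass P e E) D R}

end Codes

/-- a Heegard–Berger code: one encoder and two decoders. -/
structure HBCode (X Y Xh : Type*) (n : ℕ) where
  M : ℕ
  Mpos : 0 < M
  enc : (Fin n → X) → Fin M
  dec1 : Fin M → (Fin n → Y) → Fin n → Xh
  dec2 : Fin M → (Fin n → Y) → Fin n → Xh

section HB

variable {X Y Xh : Type*} [Fintype X] [Fintype Y] [Fintype Xh]

/-- expected distortion of one branch of a Heegard–Berger code over the memoryless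
extension of the single-letter channel `W`. -/
def hbExpDist {n M : ℕ} (P : X → ℝ) (d : X → Xh → ℝ) (W : X → Y → ℝ)
    (enc : (Fin n → X) → Fin M) (dec : Fin M → (Fin n → Y) → Fin n → Xh) : ℝ :=
  ∑ xs, ∑ ys, iid P n xs * memoryless W n xs ys * dseq d n xs (dec (enc xs) ys)

/-- achievability for the Heegard–Berger problem with side-information channels `W₁, W₂`. -/
def HBAchievable (P : X → ℝ) (d : X → Xh → ℝ) (W₁ W₂ : X → Y → ℝ) (D₁ D₂ R : ℝ) : Prop :=
  ∀ ε > (0:ℝ), ∃ n0 : ℕ, ∃ C : ∀ n, HBCode X Y Xh n, ∀ n ≥ n0,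
    Real.logb 2 ((C n).M : ℝ) / (n : ℝ) ≤ R + ε ∧
    hbExpDist P d W₁ (C n).enc (C n).dec1 ≤ D₁ + ε ∧
    hbExpDist P d W₂ (C n).enc (C n).dec2 ≤ D₂ + ε

/-- the Heegard–Berger rate-distortion function `R_HB(D₁,D₂|W₁,W₂)`. -/
def RHB (P : X → ℝ) (d : X → Xh → ℝ) (W₁ W₂ : X → Y → ℝ) (D₁ D₂ : ℝ) : ℝ :=
  sInf {R | HBAchievable P d W₁ W₂ D₁ D₂ R}

end HB

/-- the classical (no side-information) rate-distortion function `R(D)`. -/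
def RD {X Xh : Type*} [Fintype X] [Fintype Xh] (P : X → ℝ) (d : X → Xh → ℝ) (D : ℝ) : ℝ :=
  sInf ((fun Q : X → Xh → ℝ => mutInf fun p : X × Xh => P p.1 * Q p.1 p.2) ''
    {Q | IsChannel Q ∧ (∑ x, ∑ xh, P x * Q x xh * d x xh) ≤ D})

section Types

variable {X Y : Type*} [Fintype X] [Fintype Y] [DecidableEq X] [DecidableEq Y]

/-- the empirical distribution (type) `P_{x^n}` of a sequence. -/
def empDist {n : ℕ} (xs : Fin n → X) (a : X) : ℝ :=
  ((Finset.univ.filter fun t => xs t = a).card : ℝ) / n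

/-- the joint empirical distribution (joint type) of a pair of sequences. -/
def empJoint {n : ℕ} (xs : Fin n → X) (ys : Fin n → Y) (p : X × Y) : ℝ :=
  ((Finset.univ.filter fun t => xs t = p.1 ∧ ys t = p.2).card : ℝ) / n

/-- `x^n` is `P`-typical with constant `δ`. -/
def isTypical {n : ℕ} (P : X → ℝ) (δ : ℝ) (xs : Fin n → X) : Prop :=
  (∀ a, |empDist xs a - P a| ≤ δ) ∧ ∀ t, P (xs t) ≠ 0

/-- `y^n` lies in the `W`-shell `T_W(x^n)` of `x^n`. -/
def inShell {n : ℕ} (xs : Fin n → X) (ys : Fin n → Y) (W : X → Y → ℝ) : Prop :=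
  ∀ a b, empJoint xs ys (a, b) = empDist xs a * W a b

/-- cardinality of the `W`-shell of `x^n`. -/
def shellCard {n : ℕ} (xs : Fin n → X) (W : X → Y → ℝ) : ℕ :=
  Set.ncard {ys : Fin n → Y | inShell xs ys W}

end Types

/-- `W` is a conditional type with denominator `n` (all entries are multiples of `1/n`). -/
def isCondType {X Y : Type*} (n : ℕ) (W : X → Y → ℝ) : Prop :=
  ∀ x y, ∃ k : ℕ, W x y = (k : ℝ) / n

section Perm

variable {X Y Xh : Type*} [Fintype X] [Fintype Y] [Fintype Xh]

/-- probability, under the permuted source/side-information pair, that the reproduction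
distortion of the code `C` exceeds `D`. -/
def permExcess {n : ℕ} (Pxy : (Fin n → X) × (Fin n → Y) → ℝ) (C : Code X Y Xh n)
    (d : X → Xh → ℝ) (D : ℝ) (π : Equiv.Perm (Fin n)) : ℝ :=
  ∑ p : (Fin n → X) × (Fin n → Y), ∑ m,
    Pxy p * C.enc (p.1 ∘ π) m * ind (D < dseq d n (p.1 ∘ π) (C.dec m (p.2 ∘ π)))

end Perm

/-! ### Auxiliary lemmas -/

lemma aux_sum_prod {U : Type*} [Fintype U] (n : ℕ) (f : Fin n → U → ℝ) :
    ∑ u : Fin n → U, ∏ t, f t (u t) = ∏ t, ∑ a, f t a := by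
  classical
  rw [Finset.prod_univ_sum, Fintype.piFinset_univ]

lemma aux_isDist_iid {A : Type*} [Fintype A] {P : A → ℝ} (hP : IsDist P) (n : ℕ) :
    IsDist (iid P n) := by
  refine ⟨fun xs => Finset.prod_nonneg fun t _ => hP.1 _, ?_⟩
  unfold iid
  rw [aux_sum_prod n (fun _ => P)]
  simp [hP.2]

lemma aux_ind_nonneg (p : Prop) : 0 ≤ ind p := by
  unfold ind; split_ifs <;> norm_num

lemma aux_ind_le_one (p : Prop) : ind p ≤ 1 := by
  unfold ind; split_ifs <;> norm_num

lemma aux_ind_true {p : Prop} (h : p) : ind p = 1 := by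
  unfold ind; rw [if_pos h]

lemma aux_ind_false {p : Prop} (h : ¬ p) : ind p = 0 := by
  unfold ind; rw [if_neg h]

lemma aux_sum_ind {A : Type*} [Fintype A] (a : A) (f : A → ℝ) :
    ∑ b, ind (a = b) * f b = f a := by
  classical
  rw [Finset.sum_eq_single a]
  · rw [aux_ind_true rfl, one_mul]
  · intro b _ hb
    rw [aux_ind_false (fun h => hb h.symm), zero_mul]
  · simp

lemma aux_marg_gen {U : Type*} [Fintype U] (n : ℕ) (q : Fin n → U → ℝ)
    (hq : ∀ t, ∑ a, q t a = 1) (t : Fin n) (a : U) :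
    ∑ u : Fin n → U, (∏ s, q s (u s)) * ind (u t = a) = q t a := by
  classical
  have h1 : ∀ u : Fin n → U, (∏ s, q s (u s)) * ind (u t = a) =
      ∏ s, (q s (u s) * if s = t then ind (u s = a) else 1) := by
    intro u
    rw [Finset.prod_mul_distrib]
    simp
  simp_rw [h1]
  rw [aux_sum_prod n (fun s b => q s b * if s = t then ind (b = a) else 1)]
  rw [Finset.prod_eq_single t]
  · simp only [if_true]
    rw [← aux_sum_ind a (q t)]
    refine Finset.sum_congr rfl fun b _ => ?_
    rw [mul_comm]
    congr 2
    exact propext eq_comm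
  · intro s _ hs
    simp [hs, hq s]
  · simp

lemma aux_sum_cons {B : Type*} [Fintype B] (n : ℕ) (F : (Fin (n+1) → B) → ℝ) :
    ∑ bs, F bs = ∑ b : B, ∑ bs : Fin n → B, F (Fin.cons b bs) := by
  rw [← Fintype.sum_prod_type']
  exact (Fintype.sum_equiv (Fin.consEquiv (fun _ => B)) _ _ (fun x => rfl)).symm

lemma aux_iid_cons {B : Type*} (Q : B → ℝ) (n : ℕ) (b : B) (bs : Fin n → B) :
    iid Q (n+1) (Fin.cons b bs) = Q b * iid Q n bs := by
  unfold iid; rw [Fin.prod_univ_succ]; simp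

lemma aux_first_moment {B : Type*} [Fintype B] {Q : B → ℝ} (hQ : IsDist Q) (f : B → ℝ)
    (hf : ∑ b, Q b * f b = 0) (n : ℕ) :
    ∑ bs, iid Q n bs * (∑ t, f (bs t)) = 0 := by
  induction n with
  | zero => simp
  | succ n ih =>
    rw [aux_sum_cons]
    have : ∀ (b : B) (bs : Fin n → B),
        iid Q (n+1) (Fin.cons b bs) * (∑ t, f ((Fin.cons b bs : Fin (n+1) → B) t)) =
        (Q b * f b) * iid Q n bs + Q b * (iid Q n bs * ∑ t, f (bs t)) := by
      intro b bs
      rw [aux_iid_cons, Fin.sum_univ_succ]; simp; ring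
    simp_rw [this, Finset.sum_add_distrib, ← Finset.mul_sum, ih, (aux_isDist_iid hQ n).2]
    simp [hf]

lemma aux_second_moment {B : Type*} [Fintype B] {Q : B → ℝ} (hQ : IsDist Q) (f : B → ℝ)
    (hf : ∑ b, Q b * f b = 0) (n : ℕ) :
    ∑ bs, iid Q n bs * (∑ t, f (bs t))^2 = n * ∑ b, Q b * (f b)^2 := by
  induction n with
  | zero => simp
  | succ n ih =>
    rw [aux_sum_cons]
    have : ∀ (b : B) (bs : Fin n → B),
        iid Q (n+1) (Fin.cons b bs) * (∑ t, f ((Fin.cons b bs : Fin (n+1) → B) t))^2 =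
        (Q b * (f b)^2) * iid Q n bs + (2 * (Q b * f b)) * (iid Q n bs * ∑ t, f (bs t))
          + Q b * (iid Q n bs * (∑ t, f (bs t))^2) := by
      intro b bs
      rw [aux_iid_cons, Fin.sum_univ_succ]; simp; ring
    simp_rw [this, Finset.sum_add_distrib, ← Finset.mul_sum, ih, (aux_isDist_iid hQ n).2,
      aux_first_moment hQ f hf n, ← Finset.sum_mul]
    rw [hQ.2]; push_cast; ring

lemma aux_emp_dev {B : Type*} [Fintype B] {Q : B → ℝ} (hQ : IsDist Q) (h : B → ℝ)
    (K η : ℝ) (M : ℕ) (h0 : ∀ b, 0 ≤ h b) (hK : ∀ b, h b ≤ K) (h1 : ∑ b, Q b * h b ≤ 1)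
    (hη : 0 < η) (hM : 0 < M) (hKM : K ≤ η^2 * M) (hK0 : 0 ≤ K) :
    ∑ cb, iid Q M cb * |(∑ m, h (cb m)) / M - ∑ b, Q b * h b| ≤ 2 * η := by
  set μ := ∑ b, Q b * h b with hμ
  have hMr : (0:ℝ) < M := by exact_mod_cast hM
  have hiid := aux_isDist_iid hQ M
  have hmean : ∑ b, Q b * (h b - μ) = 0 := by
    simp_rw [mul_sub, Finset.sum_sub_distrib, ← Finset.sum_mul, hQ.2]
    simp [hμ]
  have hsm := aux_second_moment hQ (fun b => h b - μ) hmean M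
  have hμ0 : 0 ≤ μ := Finset.sum_nonneg fun b _ => mul_nonneg (hQ.1 b) (h0 b)
  have hvar : ∑ b, Q b * (h b - μ)^2 ≤ K := by
    have e1 : ∑ b, Q b * (h b - μ)^2 = ∑ b, Q b * (h b)^2 - μ^2 := by
      have : ∀ b, Q b * (h b - μ)^2 = Q b * (h b)^2 - 2 * μ * (Q b * h b) + μ^2 * Q b := by
        intro b; ring
      simp_rw [this, Finset.sum_add_distrib, Finset.sum_sub_distrib, ← Finset.mul_sum, hQ.2,
        ← hμ]
      ring
    have e2 : ∑ b, Q b * (h b)^2 ≤ K * μ := by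
      rw [hμ, Finset.mul_sum]
      refine Finset.sum_le_sum fun b _ => ?_
      have := mul_le_mul_of_nonneg_left (hK b) (mul_nonneg (hQ.1 b) (h0 b))
      nlinarith
    nlinarith [sq_nonneg μ]
  have hpt : ∀ cb : Fin M → B, iid Q M cb * |(∑ m, h (cb m)) / M - μ| ≤
      η * iid Q M cb + (1 / (η * M^2)) * (iid Q M cb * (∑ m, (h (cb m) - μ))^2) := by
    intro cb
    have hz : (∑ m, h (cb m)) / M - μ = (∑ m, (h (cb m) - μ)) / M := by
      rw [Finset.sum_sub_distrib]
      simp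
      field_simp
    rw [hz]
    set s := ∑ m, (h (cb m) - μ)
    have : |s / M| ≤ η + (s/M)^2 / η := by
      rw [← sq_abs (s/M)]
      set z := |s/M|
      have : 0 ≤ (z - η)^2 + z * η := by
        have : 0 ≤ z := abs_nonneg _
        positivity
      have h2 : z * η ≤ (η + z^2/η) * η := by
        have : (η + z^2/η) * η = η^2 + z^2 := by field_simp
        nlinarith
      exact le_of_mul_le_mul_right h2 hη
    have h3 := mul_le_mul_of_nonneg_left this (hiid.1 cb)
    refine h3.trans (le_of_eq ?_)
    field_simp
  refine (Finset.sum_le_sum fun cb _ => hpt cb).trans ?_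
  rw [Finset.sum_add_distrib, ← Finset.mul_sum, ← Finset.mul_sum, hiid.2, hsm]
  have : 1 / (η * (M:ℝ)^2) * (M * ∑ b, Q b * (h b - μ)^2) ≤ η := by
    have e : 1 / (η * (M:ℝ)^2) * (M * ∑ b, Q b * (h b - μ)^2)
        = (∑ b, Q b * (h b - μ)^2) / (η * M) := by field_simp
    rw [e, div_le_iff₀ (by positivity)]
    nlinarith
  linarith

lemma aux_exists_le {B : Type*} [Fintype B] {Q : B → ℝ} (hQ : IsDist Q) (F : B → ℝ) (c : ℝ)
    (h : ∑ b, Q b * F b ≤ c) : ∃ b, F b ≤ c := by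
  by_contra hcon
  push Not at hcon
  have h1 : ∑ b, Q b * c < ∑ b, Q b * F b := by
    have hex : ∃ b, Q b ≠ 0 := by
      by_contra h0
      push Not at h0
      have := hQ.2
      simp [h0] at this
    obtain ⟨b, hb⟩ := hex
    refine Finset.sum_lt_sum (fun b _ => mul_le_mul_of_nonneg_left (hcon b).le (hQ.1 b))
      ⟨b, Finset.mem_univ _, mul_lt_mul_of_pos_left (hcon b) (lt_of_le_of_ne (hQ.1 b) hb.symm)⟩
  rw [← Finset.sum_mul, hQ.2, one_mul] at h1
  linarith

lemma aux_typical {B : Type*} [Fintype B] {J : B → ℝ} (hJ : IsDist J) (L : B → ℝ)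
    (hL : ∀ b, J b ≠ 0 → 0 < L b) (I : ℝ) (hI : ∑ b, J b * Real.logb 2 (L b) = I)
    (δ η : ℝ) (hδ : 0 < δ) (hη : 0 < η) :
    ∃ n0 : ℕ, ∀ n ≥ n0,
      ∑ bs, iid J n bs * ind ((2:ℝ) ^ ((n:ℝ) * (I + δ)) < ∏ t, L (bs t)) ≤ η := by
  set σ := ∑ b, J b * (Real.logb 2 (L b) - I)^2 with hσ
  have hσ0 : 0 ≤ σ := Finset.sum_nonneg fun b _ => mul_nonneg (hJ.1 b) (sq_nonneg _)
  obtain ⟨n0, hn0⟩ := exists_nat_gt (σ / (δ^2 * η))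
  refine ⟨max n0 1, fun n hn => ?_⟩
  have hn1 : 1 ≤ n := le_trans (le_max_right _ _) hn
  have hnr : (0:ℝ) < n := by exact_mod_cast hn1
  have hnn : (n0:ℝ) ≤ n := by exact_mod_cast le_trans (le_max_left _ _) hn
  have hmean : ∑ b, J b * (Real.logb 2 (L b) - I) = 0 := by
    simp_rw [mul_sub, Finset.sum_sub_distrib, ← Finset.sum_mul, hJ.2, hI]
    simp
  have hsm := aux_second_moment hJ (fun b => Real.logb 2 (L b) - I) hmean n
  have hpt : ∀ bs : Fin n → B,
      iid J n bs * ind ((2:ℝ) ^ ((n:ℝ) * (I + δ)) < ∏ t, L (bs t)) ≤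
      (1 / (n * δ)^2) * (iid J n bs * (∑ t, (Real.logb 2 (L (bs t)) - I))^2) := by
    intro bs
    have hi0 : 0 ≤ iid J n bs := (aux_isDist_iid hJ n).1 bs
    by_cases h0 : iid J n bs = 0
    · simp [h0]
    by_cases hc : (2:ℝ) ^ ((n:ℝ) * (I + δ)) < ∏ t, L (bs t)
    · rw [aux_ind_true hc]
      have hpos : ∀ t, 0 < L (bs t) := by
        intro t
        apply hL
        intro h
        exact h0 (Finset.prod_eq_zero (Finset.mem_univ t) h)
      have hlog : (n:ℝ) * (I + δ) < ∑ t, Real.logb 2 (L (bs t)) := by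
        have := Real.logb_lt_logb (b := 2) (by norm_num) (by positivity) hc
        rw [Real.logb_rpow (by norm_num) (by norm_num)] at this
        rwa [Real.logb_prod _ _ (fun t _ => (hpos t).ne')] at this
      have hs : n * δ ≤ ∑ t, (Real.logb 2 (L (bs t)) - I) := by
        rw [Finset.sum_sub_distrib]; simp; linarith
      have hnd : 0 < n * δ := by positivity
      have hsq : (n * δ)^2 ≤ (∑ t, (Real.logb 2 (L (bs t)) - I))^2 :=
        pow_le_pow_left₀ hnd.le hs 2
      rw [one_div_mul_eq_div, le_div_iff₀ (by positivity), mul_one]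
      exact mul_le_mul_of_nonneg_left hsq hi0
    · rw [aux_ind_false hc, mul_zero]
      positivity
  refine (Finset.sum_le_sum fun bs _ => hpt bs).trans ?_
  rw [← Finset.mul_sum, hsm, ← hσ]
  have e : 1 / (n * δ)^2 * (n * σ) = σ / (n * δ^2) := by field_simp
  rw [e, div_le_iff₀ (by positivity)]
  rw [div_lt_iff₀ (by positivity)] at hn0
  nlinarith [mul_le_mul_of_nonneg_right hnn (show 0 ≤ δ^2*η by positivity)]

/-- Information density formula. -/
lemma aux_mutInf {X U : Type*} [Fintype X] [Fintype U] {P : X → ℝ} (hP : IsDist P)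
    {V : X → U → ℝ} (hV : IsChannel V) :
    mutInf (fun p : U × X => P p.2 * V p.2 p.1) =
      ∑ p : U × X, (P p.2 * V p.2 p.1) * Real.logb 2 (V p.2 p.1 / ∑ x, P x * V x p.1) := by
  unfold mutInf ent
  have h2 : ∀ x, ∑ u, P x * V x u = P x := by
    intro x; rw [← Finset.mul_sum, (hV x).2, mul_one]
  simp only [h2]
  rw [Fintype.sum_prod_type, Fintype.sum_prod_type]
  have h3 : ∑ x, P x * Real.logb 2 (P x) = ∑ u, ∑ x, (P x * V x u) * Real.logb 2 (P x) := by
    rw [Finset.sum_comm]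
    refine Finset.sum_congr rfl fun x _ => ?_
    rw [← Finset.sum_mul, h2]
  rw [h3]
  simp_rw [Finset.sum_mul]
  rw [← sub_eq_zero]
  simp only [← Finset.sum_neg_distrib, ← Finset.sum_add_distrib, ← Finset.sum_sub_distrib]
  refine Finset.sum_eq_zero fun u _ => Finset.sum_eq_zero fun x _ => ?_
  by_cases h0 : P x * V x u = 0
  · simp [h0]
  have hx : P x ≠ 0 := left_ne_zero_of_mul h0
  have hv : V x u ≠ 0 := right_ne_zero_of_mul h0
  have hpos : 0 < ∑ x, P x * V x u :=
    lt_of_lt_of_le (lt_of_le_of_ne (mul_nonneg (hP.1 x) ((hV x).1 u)) (Ne.symm h0))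
      (Finset.single_le_sum (f := fun x => P x * V x u)
        (fun x _ => mul_nonneg (hP.1 x) ((hV x).1 u)) (Finset.mem_univ x))
  rw [Real.logb_div hv hpos.ne', Real.logb_mul hx hv]
  ring

lemma aux_PU {X U : Type*} [Fintype X] [Fintype U] {P : X → ℝ} (hP : IsDist P)
    {V : X → U → ℝ} (hV : IsChannel V) : IsDist (fun u => ∑ x, P x * V x u) := by
  refine ⟨fun u => Finset.sum_nonneg fun x _ => mul_nonneg (hP.1 x) ((hV x).1 u), ?_⟩
  rw [Finset.sum_comm]
  simp_rw [← Finset.mul_sum, (hV _).2, mul_one, hP.2]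

lemma aux_J {X U : Type*} [Fintype X] [Fintype U] {P : X → ℝ} (hP : IsDist P)
    {V : X → U → ℝ} (hV : IsChannel V) : IsDist (fun p : U × X => P p.2 * V p.2 p.1) := by
  refine ⟨fun p => mul_nonneg (hP.1 _) ((hV _).1 _), ?_⟩
  rw [Fintype.sum_prod_type]
  exact (aux_PU hP hV).2

lemma aux_PU_pos {X U : Type*} [Fintype X] [Fintype U] {P : X → ℝ} (hP : IsDist P)
    {V : X → U → ℝ} (hV : IsChannel V) (x : X) (u : U) (h0 : P x * V x u ≠ 0) :
    0 < ∑ x, P x * V x u :=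
  lt_of_lt_of_le (lt_of_le_of_ne (mul_nonneg (hP.1 x) ((hV x).1 u)) (Ne.symm h0))
      (Finset.single_le_sum (f := fun x => P x * V x u)
        (fun x _ => mul_nonneg (hP.1 x) ((hV x).1 u)) (Finset.mem_univ x))

lemma aux_mutInf_nonneg {X U : Type*} [Fintype X] [Fintype U] {P : X → ℝ} (hP : IsDist P)
    {V : X → U → ℝ} (hV : IsChannel V) :
    0 ≤ mutInf (fun p : U × X => P p.2 * V p.2 p.1) := by
  rw [aux_mutInf hP hV]
  have hl2 : 0 < Real.log 2 := Real.log_pos (by norm_num)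
  have key : ∀ p : U × X, (P p.2 * V p.2 p.1 - P p.2 * ∑ x, P x * V x p.1) / Real.log 2 ≤
      (P p.2 * V p.2 p.1) * Real.logb 2 (V p.2 p.1 / ∑ x, P x * V x p.1) := by
    rintro ⟨u, x⟩
    simp only
    unfold Real.logb
    rw [mul_div_assoc']
    refine div_le_div_of_nonneg_right ?_ hl2.le
    by_cases h0 : P x * V x u = 0
    · have := mul_nonneg (hP.1 x) ((aux_PU hP hV).1 u)
      simp only [h0, zero_mul]
      linarith
    have hpos := aux_PU_pos hP hV x u h0
    set q := ∑ x, P x * V x u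
    have hx : 0 < P x := lt_of_le_of_ne (hP.1 x) (left_ne_zero_of_mul h0).symm
    have hv : 0 < V x u := lt_of_le_of_ne ((hV x).1 u) (right_ne_zero_of_mul h0).symm
    have := Real.one_sub_inv_le_log_of_pos (div_pos hv hpos)
    have h4 := mul_le_mul_of_nonneg_left this (mul_pos hx hv).le
    refine le_trans (le_of_eq ?_) h4
    field_simp
  refine le_trans (le_of_eq ?_) (Finset.sum_le_sum fun p _ => key p)
  rw [← Finset.sum_div, Finset.sum_sub_distrib, (aux_J hP hV).2, Fintype.sum_prod_type]
  simp_rw [← Finset.sum_mul, hP.2, one_mul]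
  rw [(aux_PU hP hV).2]; simp

lemma aux_oneshot {X U : Type*} [Fintype X] [Fintype U] {P : X → ℝ} (hP : IsDist P)
    {V : X → U → ℝ} (hV : IsChannel V) (n M : ℕ) (hn : 0 < n) (hM : 0 < M) (K η : ℝ)
    (hK : 0 ≤ K) (hη : 0 < η) (hKM : K ≤ η^2 * M)
    (htyp : ∑ xs : Fin n → X, ∑ us : Fin n → U, iid P n xs * (∏ t, V (xs t) (us t)) *
      ind (K < ∏ t, (V (xs t) (us t) / ∑ x, P x * V x (us t))) ≤ η) :
    ∃ cb : Fin M → Fin n → U, ∃ enc : (Fin n → X) → Fin M → ℝ, IsChannel enc ∧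
      ∑ xs, iid P n xs * ((∑ t, ∑ a, max 0 (∑ m, enc xs m * ind (cb m t = a) - V (xs t) a)) / n)
        ≤ (2 * Fintype.card U + 3) * η := by
  have hnr : (0:ℝ) < n := by exact_mod_cast hn
  have hMr : (0:ℝ) < M := by exact_mod_cast hM
  set PU : U → ℝ := fun u => ∑ x, P x * V x u with hPUdef
  have hPU : IsDist PU := aux_PU hP hV
  have hPn := aux_isDist_iid hP n
  have hPUn := aux_isDist_iid hPU n
  set L : (Fin n → X) → (Fin n → U) → ℝ := fun xs us => ∏ t, (V (xs t) (us t) / PU (us t))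
    with hL
  have hL0 : ∀ xs us, 0 ≤ L xs us := fun xs us =>
    Finset.prod_nonneg fun t _ => div_nonneg ((hV _).1 _) (hPU.1 _)
  set h : (Fin n → X) → (Fin n → U) → ℝ := fun xs us => L xs us * (1 - ind (K < L xs us))
    with hh
  have hh0 : ∀ xs us, 0 ≤ h xs us := fun xs us =>
    mul_nonneg (hL0 _ _) (sub_nonneg.2 (aux_ind_le_one _))
  have hhL : ∀ xs us, h xs us ≤ L xs us := fun xs us => by
    have := mul_nonneg (hL0 xs us) (aux_ind_nonneg (K < L xs us))
    simp only [hh]; linarith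
  have hhK : ∀ xs us, h xs us ≤ K := fun xs us => by
    by_cases hc : K < L xs us
    · simp only [hh, aux_ind_true hc]; simpa using hK
    · simp only [hh, aux_ind_false hc]; simpa using hc
  have hVn : ∀ xs : Fin n → X, ∑ us : Fin n → U, ∏ t, V (xs t) (us t) = 1 := by
    intro xs
    rw [aux_sum_prod n (fun t u => V (xs t) u)]
    simp [(hV _).2]
  have hle : ∀ xs us, iid PU n us * h xs us ≤ ∏ t, V (xs t) (us t) := by
    intro xs us
    refine (mul_le_mul_of_nonneg_left (hhL xs us) (hPUn.1 us)).trans ?_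
    simp only [hL, iid]
    rw [← Finset.prod_mul_distrib]
    refine Finset.prod_le_prod (fun t _ => mul_nonneg (hPU.1 _)
      (div_nonneg ((hV _).1 _) (hPU.1 _))) fun t _ => ?_
    by_cases h0 : PU (us t) = 0
    · simp [h0, (hV _).1]
    · exact le_of_eq (by field_simp)
  set s : (Fin n → X) → ℝ := fun xs => ∑ us, iid PU n us * h xs us with hs
  have hs1 : ∀ xs, s xs ≤ 1 := fun xs => by
    rw [← hVn xs]; exact Finset.sum_le_sum fun us _ => hle xs us
  set g : (Fin n → X) → Fin n → U → ℝ :=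
    fun xs t a => ∑ us, iid PU n us * (h xs us * ind (us t = a)) with hg
  have hgV : ∀ xs t a, g xs t a ≤ V (xs t) a := by
    intro xs t a
    rw [← aux_marg_gen n (fun t u => V (xs t) u) (fun t => (hV _).2) t a]
    refine Finset.sum_le_sum fun us _ => ?_
    rw [← mul_assoc]
    exact mul_le_mul_of_nonneg_right (hle xs us) (aux_ind_nonneg _)
  have hV1 : ∀ x a, V x a ≤ 1 := fun x a => by
    rw [← (hV x).2]; exact Finset.single_le_sum (fun b _ => (hV x).1 b) (Finset.mem_univ a)
  have hB : ∑ xs, iid P n xs * (1 - s xs) ≤ η := by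
    refine le_trans (le_of_eq ?_) htyp
    refine Finset.sum_congr rfl fun xs _ => ?_
    rw [← hVn xs, hs, ← Finset.sum_sub_distrib, Finset.mul_sum]
    refine Finset.sum_congr rfl fun us _ => ?_
    have e : iid P n xs * (iid PU n us * L xs us) = iid P n xs * ∏ t, V (xs t) (us t) := by
      simp only [hL, iid]
      rw [← Finset.prod_mul_distrib, ← Finset.prod_mul_distrib, ← Finset.prod_mul_distrib]
      refine Finset.prod_congr rfl fun t _ => ?_
      by_cases h0 : P (xs t) * V (xs t) (us t) = 0
      · rw [h0]
        have : P (xs t) * (PU (us t) * (V (xs t) (us t) / PU (us t))) =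
          (P (xs t) * V (xs t) (us t)) * (PU (us t) / PU (us t)) := by ring
        rw [this, h0, zero_mul]
      · have : PU (us t) ≠ 0 := (aux_PU_pos hP hV _ _ h0).ne'
        field_simp
    have e2 : iid P n xs * (∏ t, V (xs t) (us t) - iid PU n us * h xs us) =
        iid P n xs * ∏ t, V (xs t) (us t) -
        (iid P n xs * (iid PU n us * L xs us)) * (1 - ind (K < L xs us)) := by
      simp only [hh]; ring
    rw [e2, e]; simp only [hL]; ring
  set S : (Fin M → Fin n → U) → (Fin n → X) → ℝ := fun cb xs => (∑ m, h xs (cb m)) / M with hS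
  set G : (Fin M → Fin n → U) → (Fin n → X) → Fin n → U → ℝ :=
    fun cb xs t a => (∑ m, h xs (cb m) * ind (cb m t = a)) / M with hG
  have hES : ∀ xs, ∑ cb, iid (iid PU n) M cb * |S cb xs - s xs| ≤ 2 * η := fun xs =>
    aux_emp_dev hPUn (h xs) K η M (hh0 xs) (hhK xs) (hs1 xs) hη hM hKM hK
  have hEG : ∀ xs t a, ∑ cb, iid (iid PU n) M cb * |G cb xs t a - g xs t a| ≤ 2 * η :=
    fun xs t a =>
    aux_emp_dev hPUn (fun us => h xs us * ind (us t = a)) K η M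
      (fun us => mul_nonneg (hh0 xs us) (aux_ind_nonneg _))
      (fun us => (mul_le_of_le_one_right (hh0 xs us) (aux_ind_le_one _)).trans (hhK xs us))
      ((hgV xs t a).trans (hV1 _ _)) hη hM hKM hK
  set F : (Fin M → Fin n → U) → ℝ := fun cb => ∑ xs, iid P n xs *
    ((∑ t, ∑ a, |G cb xs t a - g xs t a|) / n + |S cb xs - s xs| + (1 - s xs)) with hF
  have hcbd := aux_isDist_iid hPUn M
  have hEF : ∑ cb, iid (iid PU n) M cb * F cb ≤ (2 * Fintype.card U + 3) * η := by
    have e1 : ∑ cb, iid (iid PU n) M cb * F cb = ∑ xs, iid P n xs *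
        ((∑ t, ∑ a, ∑ cb, iid (iid PU n) M cb * |G cb xs t a - g xs t a|) / n
          + ∑ cb, iid (iid PU n) M cb * |S cb xs - s xs| + (1 - s xs)) := by
      simp only [hF, Finset.mul_sum]
      rw [Finset.sum_comm]
      refine Finset.sum_congr rfl fun xs _ => ?_
      have e2 : ∑ t, ∑ a, ∑ cb, iid (iid PU n) M cb * |G cb xs t a - g xs t a| =
          ∑ cb, iid (iid PU n) M cb * ∑ t, ∑ a, |G cb xs t a - g xs t a| := by
        simp only [Finset.mul_sum]
        symm
        rw [Finset.sum_comm]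
        refine Finset.sum_congr rfl fun t _ => ?_
        rw [Finset.sum_comm]
      have e3 : (1 - s xs) = ∑ cb, iid (iid PU n) M cb * (1 - s xs) := by
        rw [← Finset.sum_mul, hcbd.2, one_mul]
      rw [e2, e3, Finset.sum_div, ← Finset.sum_add_distrib, ← Finset.sum_add_distrib,
        Finset.mul_sum]
      refine Finset.sum_congr rfl fun cb _ => ?_
      rw [← e3]
      ring
    rw [e1]
    have e4 : ∀ xs, iid P n xs *
        ((∑ t, ∑ a, ∑ cb, iid (iid PU n) M cb * |G cb xs t a - g xs t a|) / n
          + ∑ cb, iid (iid PU n) M cb * |S cb xs - s xs| + (1 - s xs)) ≤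
        iid P n xs * (2 * Fintype.card U * η + 2 * η) + iid P n xs * (1 - s xs) := by
      intro xs
      rw [← mul_add]
      refine mul_le_mul_of_nonneg_left ?_ (hPn.1 xs)
      have e5 : (∑ t : Fin n, ∑ a, ∑ cb, iid (iid PU n) M cb * |G cb xs t a - g xs t a|) / n
          ≤ 2 * Fintype.card U * η := by
        rw [div_le_iff₀ hnr]
        refine (Finset.sum_le_sum fun t _ => Finset.sum_le_sum fun a _ => hEG xs t a).trans ?_
        simp
        exact le_of_eq (by ring)
      linarith [hES xs]
    refine (Finset.sum_le_sum fun xs _ => e4 xs).trans ?_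
    rw [Finset.sum_add_distrib, ← Finset.sum_mul, hPn.2]
    linarith
  obtain ⟨cb, hcb⟩ := aux_exists_le hcbd F _ hEF
  have hS0 : ∀ xs, 0 ≤ S cb xs := fun xs =>
    div_nonneg (Finset.sum_nonneg fun m _ => hh0 _ _) hMr.le
  have hG0 : ∀ xs t a, 0 ≤ G cb xs t a := fun xs t a =>
    div_nonneg (Finset.sum_nonneg fun m _ => mul_nonneg (hh0 _ _) (aux_ind_nonneg _)) hMr.le
  set m0 : Fin M := ⟨0, hM⟩
  set N : (Fin n → X) → ℝ := fun xs => max (S cb xs) 1 with hN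
  have hN1 : ∀ xs, 1 ≤ N xs := fun xs => le_max_right _ _
  have hN0 : ∀ xs, 0 < N xs := fun xs => lt_of_lt_of_le one_pos (hN1 xs)
  have hr0 : ∀ xs, 0 ≤ 1 - S cb xs / N xs := fun xs =>
    sub_nonneg.2 ((div_le_one (hN0 xs)).2 (le_max_left _ _))
  have hr1 : ∀ xs, 1 - S cb xs / N xs ≤ |S cb xs - s xs| + (1 - s xs) := fun xs => by
    rcases le_total 1 (S cb xs) with hc | hc
    · have : N xs = S cb xs := max_eq_left hc
      rw [this, div_self (by linarith)]
      have := abs_nonneg (S cb xs - s xs)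
      linarith [hs1 xs]
    · have : N xs = 1 := max_eq_right hc
      rw [this, div_one]
      linarith [neg_abs_le (S cb xs - s xs)]
  refine ⟨cb, fun xs m => h xs (cb m) / M / N xs + ind (m0 = m) * (1 - S cb xs / N xs),
    fun xs => ⟨fun m => ?_, ?_⟩, ?_⟩
  · exact add_nonneg (div_nonneg (div_nonneg (hh0 _ _) hMr.le) (hN0 xs).le)
      (mul_nonneg (aux_ind_nonneg _) (hr0 xs))
  · rw [Finset.sum_add_distrib, aux_sum_ind m0 (fun _ => 1 - S cb xs / N xs),
      ← Finset.sum_div, ← Finset.sum_div]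
    simp only [hS]; ring
  refine le_trans ?_ hcb
  refine Finset.sum_le_sum fun xs _ => mul_le_mul_of_nonneg_left ?_ (hPn.1 xs)
  set κ := |S cb xs - s xs| + (1 - s xs) with hκ
  have hκ0 : 0 ≤ κ := (hr0 xs).trans (hr1 xs)
  have hQ : ∀ t a, max 0 (∑ m, (h xs (cb m) / M / N xs + ind (m0 = m) * (1 - S cb xs / N xs))
      * ind (cb m t = a) - V (xs t) a) ≤ |G cb xs t a - g xs t a| + ind (cb m0 t = a) * κ := by
    intro t a
    have hi := aux_ind_nonneg (cb m0 t = a)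
    refine max_le (add_nonneg (abs_nonneg _) (mul_nonneg hi hκ0)) ?_
    have e1 : ∑ m, (h xs (cb m) / M / N xs + ind (m0 = m) * (1 - S cb xs / N xs))
      * ind (cb m t = a) = G cb xs t a / N xs + (1 - S cb xs / N xs) * ind (cb m0 t = a) := by
      rw [← aux_sum_ind m0 (fun m => (1 - S cb xs / N xs) * ind (cb m t = a))]
      simp only [hG, Finset.sum_div]
      rw [← Finset.sum_add_distrib]
      refine Finset.sum_congr rfl fun m _ => ?_
      ring
    rw [e1]
    have e2 : G cb xs t a / N xs ≤ G cb xs t a := div_le_self (hG0 _ _ _) (hN1 xs)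
    have e3 := mul_le_mul_of_nonneg_right (hr1 xs) hi
    have e4 := le_abs_self (G cb xs t a - g xs t a)
    have e5 := hgV xs t a
    rw [← hκ] at e3
    linarith
  rw [add_assoc, ← hκ, div_add' _ _ _ hnr.ne', div_le_div_iff_of_pos_right hnr]
  refine (Finset.sum_le_sum fun t _ => Finset.sum_le_sum fun a _ => hQ t a).trans ?_
  simp_rw [Finset.sum_add_distrib]
  have : ∀ t, ∑ a, ind (cb m0 t = a) * κ = κ := fun t => aux_sum_ind (cb m0 t) (fun _ => κ)
  simp_rw [this]
  simp
  exact le_of_eq (mul_comm _ _)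

lemma aux_code {X U : Type*} [Fintype X] [Fintype U] {P : X → ℝ} (hP : IsDist P)
    {V : X → U → ℝ} (hV : IsChannel V) (I : ℝ)
    (hI : mutInf (fun p : U × X => P p.2 * V p.2 p.1) = I)
    (δ η : ℝ) (hδ : 0 < δ) (hη : 0 < η) :
    ∃ n0 : ℕ, ∀ n ≥ n0, ∃ M : ℕ, 0 < M ∧ Real.logb 2 M / n ≤ I + δ ∧
      ∃ cb : Fin M → Fin n → U, ∃ enc : (Fin n → X) → Fin M → ℝ, IsChannel enc ∧
      ∑ xs, iid P n xs * ((∑ t, ∑ a, max 0 (∑ m, enc xs m * ind (cb m t = a) - V (xs t) a)) / n)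
        ≤ η := by
  have hI0 : 0 ≤ I := hI ▸ aux_mutInf_nonneg hP hV
  set c : ℝ := 2 * Fintype.card U + 3 with hc
  have hc0 : 0 < c := by positivity
  set η' := η / c with hη'
  have hη'0 : 0 < η' := div_pos hη hc0
  obtain ⟨n1, hn1⟩ := aux_typical (aux_J hP hV)
    (fun p : U × X => V p.2 p.1 / ∑ x, P x * V x p.1)
    (fun p hp => div_pos (lt_of_le_of_ne ((hV _).1 _) (right_ne_zero_of_mul hp).symm)
      (aux_PU_pos hP hV _ _ hp)) I (by rw [← hI, aux_mutInf hP hV]) (δ/3) η' (by positivity) hη'0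
  have hlim : Filter.Tendsto (fun n : ℕ => (2:ℝ) ^ ((n:ℝ) * (δ/3))) Filter.atTop Filter.atTop := by
    have : ∀ n : ℕ, (2:ℝ) ^ ((n:ℝ) * (δ/3)) = ((2:ℝ)^(δ/3))^n := by
      intro n
      rw [mul_comm, Real.rpow_mul (by norm_num), Real.rpow_natCast]
    simp_rw [this]
    exact tendsto_pow_atTop_atTop_of_one_lt (Real.one_lt_rpow (by norm_num) (by positivity))
  obtain ⟨n2, hn2⟩ := Filter.eventually_atTop.1
    ((hlim.eventually_ge_atTop (1 / η'^2)).and (hlim.eventually_ge_atTop 2))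
  refine ⟨max (max n1 n2) 1, fun n hn => ?_⟩
  have hn0 : 0 < n := lt_of_lt_of_le one_pos ((le_max_right _ _).trans hn)
  have hnr : (0:ℝ) < n := by exact_mod_cast hn0
  have hnn1 := hn1 n (((le_max_left _ _).trans (le_max_left _ _)).trans hn)
  obtain ⟨ha, hb⟩ := hn2 n (((le_max_right _ _).trans (le_max_left _ _)).trans hn)
  set T := (2:ℝ) ^ ((n:ℝ) * (I + 2 * (δ/3))) with hT
  have hT1 : 1 ≤ T := Real.one_le_rpow (by norm_num) (by positivity)
  have hM0 : 0 < ⌈T⌉₊ := Nat.ceil_pos.2 (by linarith)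
  have hMT : T ≤ (⌈T⌉₊ : ℝ) := Nat.le_ceil T
  have hMT2 : (⌈T⌉₊ : ℝ) ≤ 2 * T := by
    have := Nat.ceil_lt_add_one (show 0 ≤ T by linarith)
    linarith
  refine ⟨⌈T⌉₊, hM0, ?_, ?_⟩
  · rw [div_le_iff₀ hnr]
    have h1 : (⌈T⌉₊ : ℝ) ≤ (2:ℝ) ^ ((I + δ) * n) := by
      refine hMT2.trans ?_
      have : (2:ℝ) ^ ((I + δ) * n) = (2:ℝ) ^ ((n:ℝ) * (δ/3)) * T := by
        rw [hT, ← Real.rpow_add (by norm_num)]; congr 1; ring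
      rw [this]
      exact mul_le_mul_of_nonneg_right hb (by linarith)
    have := Real.logb_le_logb_of_le (b := 2) (by norm_num) (by exact_mod_cast hM0) h1
    rwa [Real.logb_rpow (by norm_num) (by norm_num)] at this
  · have hone := aux_oneshot hP hV n ⌈T⌉₊ hn0 hM0 ((2:ℝ) ^ ((n:ℝ) * (I + δ/3))) η'
      (by positivity) hη'0 ?_ ?_
    · obtain ⟨cb, enc, h1, h2⟩ := hone
      refine ⟨cb, enc, h1, h2.trans (le_of_eq ?_)⟩
      rw [← hc, hη']; field_simp
    · refine le_trans ?_ (mul_le_mul_of_nonneg_left hMT (sq_nonneg η'))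
      have e : T = (2:ℝ) ^ ((n:ℝ) * (δ/3)) * (2:ℝ) ^ ((n:ℝ) * (I + δ/3)) := by
        rw [hT, ← Real.rpow_add (by norm_num)]; congr 1; ring
      rw [e, ← mul_assoc]
      refine le_mul_of_one_le_left (by positivity) ?_
      rw [div_le_iff₀ (by positivity)] at ha
      linarith
    · refine le_trans (le_of_eq ?_) hnn1
      rw [← (Equiv.arrowProdEquivProdArrow (Fin n) (fun _ => U) (fun _ => X)).symm.sum_comp,
        Fintype.sum_prod_type, Finset.sum_comm]
      refine Finset.sum_congr rfl fun us _ => Finset.sum_congr rfl fun xs _ => ?_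
      simp only [iid, Equiv.arrowProdEquivProdArrow]
      simp [Finset.prod_mul_distrib]

lemma aux_Wbar {X Y : Type*} [Fintype X] [Fintype Y] [Nonempty Y] {P : X → ℝ} (hP : IsDist P)
    {n : ℕ} (hn : 0 < n) {Wn : (Fin n → X) → (Fin n → Y) → ℝ} (hW : IsChannel Wn) :
    ∃ W : X → Y → ℝ, IsChannel W ∧ ∀ F : X → Y → ℝ,
      ∑ xs, ∑ ys, iid P n xs * Wn xs ys * dseq F n xs ys = ∑ x, ∑ y, P x * W x y * F x y := by
  classical
  have hnr : (0:ℝ) < n := by exact_mod_cast hn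
  have hPn := aux_isDist_iid hP n
  set J : X → Y → ℝ := fun a b => ∑ xs, ∑ ys, iid P n xs * Wn xs ys *
    dseq (fun x y => ind (x = a) * ind (y = b)) n xs ys with hJ
  have hJ0 : ∀ a b, 0 ≤ J a b := fun a b => Finset.sum_nonneg fun xs _ =>
    Finset.sum_nonneg fun ys _ => mul_nonneg (mul_nonneg (hPn.1 _) ((hW _).1 _))
      (div_nonneg (Finset.sum_nonneg fun t _ =>
        mul_nonneg (aux_ind_nonneg _) (aux_ind_nonneg _)) hnr.le)
  have hlin : ∀ F : X → Y → ℝ, ∑ xs, ∑ ys, iid P n xs * Wn xs ys * dseq F n xs ys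
      = ∑ x, ∑ y, J x y * F x y := by
    intro F
    have hF : ∀ (xs : Fin n → X) (ys : Fin n → Y), dseq F n xs ys =
        ∑ x, ∑ y, dseq (fun x' y' => ind (x' = x) * ind (y' = y)) n xs ys * F x y := by
      intro xs ys
      unfold dseq
      have : ∀ t, F (xs t) (ys t) = ∑ x, ∑ y, (ind (xs t = x) * ind (ys t = y)) * F x y := by
        intro t
        simp_rw [mul_assoc, ← Finset.mul_sum, aux_sum_ind]
      simp_rw [this, Finset.sum_div, Finset.sum_mul]
      rw [Finset.sum_comm]
      refine Finset.sum_congr rfl fun x _ => ?_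
      rw [Finset.sum_comm]
      refine Finset.sum_congr rfl fun y _ => Finset.sum_congr rfl fun t _ => ?_
      ring
    simp_rw [hF, hJ, Finset.mul_sum, Finset.sum_mul]
    simp_rw [← Fintype.sum_prod_type']
    refine Fintype.sum_equiv ⟨fun p => (p.2.2.1, p.2.2.2, p.1, p.2.1),
      fun p => (p.2.2.1, p.2.2.2, p.1, p.2.1), fun _ => rfl, fun _ => rfl⟩ _ _ fun p => ?_
    simp only [Equiv.coe_fn_mk]
    ring
  have hJP : ∀ a, ∑ b, J a b = P a := by
    intro a
    have h1 := hlin (fun x _ => ind (a = x))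
    have h2 : ∑ x, ∑ y, J x y * ind (a = x) = ∑ b, J a b := by
      simp_rw [← Finset.sum_mul]
      rw [← aux_sum_ind a (fun x => ∑ y, J x y)]
      refine Finset.sum_congr rfl fun x _ => mul_comm _ _
    rw [← h2, ← h1]
    have h3 : ∀ (xs : Fin n → X) (ys : Fin n → Y),
        dseq (fun x _ => ind (a = x)) n xs ys = (∑ t, ind (xs t = a)) / n := by
      intro xs ys; unfold dseq
      congr 1
      refine Finset.sum_congr rfl fun t _ => ?_
      refine congrArg ind ?_
      exact propext eq_comm
    simp_rw [h3, ← Finset.sum_mul, ← Finset.mul_sum, (hW _).2, mul_one]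
    simp_rw [mul_div_assoc', ← Finset.sum_div, Finset.mul_sum]
    rw [Finset.sum_comm]
    have h4 : ∀ t : Fin n, ∑ xs, iid P n xs * ind (xs t = a) = P a := fun t =>
      aux_marg_gen n (fun _ => P) (fun _ => hP.2) t a
    simp_rw [h4]
    simp
    field_simp
  obtain ⟨y0⟩ := ‹Nonempty Y›
  refine ⟨fun x y => if P x = 0 then ind (y0 = y) else J x y / P x, fun x => ?_, fun F => ?_⟩
  · by_cases h0 : P x = 0
    · simp only [h0, if_true]
      refine ⟨fun y => aux_ind_nonneg _, ?_⟩
      have := aux_sum_ind y0 (fun _ => (1:ℝ))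
      simpa using this
    · simp only [h0, if_false]
      refine ⟨fun y => div_nonneg (hJ0 _ _) (hP.1 _), ?_⟩
      rw [← Finset.sum_div, hJP, div_self h0]
  · rw [hlin]
    refine Finset.sum_congr rfl fun x _ => Finset.sum_congr rfl fun y _ => ?_
    by_cases h0 : P x = 0
    · have h1 : ∑ b, J x b = 0 := by rw [hJP, h0]
      have := (Finset.sum_eq_zero_iff_of_nonneg (fun b _ => hJ0 x b)).1 h1 y (Finset.mem_univ _)
      simp [this, h0]
    · simp only [h0, if_false]
      field_simp

lemma aux_achievable {X Y Xh : Type*} [Fintype X] [Fintype Y] [Fintype Xh] [DecidableEq Y]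
    [Nonempty Y] [Nonempty Xh]
    (P : X → ℝ) (hP : IsDist P) (e : X → Y → ℝ)
    (d : X → Xh → ℝ) (hd0 : ∀ x xh, 0 ≤ d x xh) (D E : ℝ)
    (V : X → (Y → Xh) → ℝ) (hV : V ∈ Vrob P e d E D) :
    Achievable P d (AvgClass P e E) D
      (mutInf (fun p : (Y → Xh) × X => P p.2 * V p.2 p.1)) := by
  intro ε hε
  obtain ⟨hVc, hVD⟩ := hV
  set dm : ℝ := 1 + ∑ x, ∑ xh, d x xh with hdm
  have hdm0 : 0 < dm := by
    have : 0 ≤ ∑ x, ∑ xh, d x xh :=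
      Finset.sum_nonneg fun x _ => Finset.sum_nonneg fun xh _ => hd0 x xh
    linarith
  have hdle : ∀ x xh, d x xh ≤ dm := fun x xh => by
    have h1 : d x xh ≤ ∑ xh, d x xh :=
      Finset.single_le_sum (fun b _ => hd0 x b) (Finset.mem_univ xh)
    have h2 : ∑ xh, d x xh ≤ ∑ x, ∑ xh, d x xh :=
      Finset.single_le_sum (f := fun x => ∑ xh, d x xh)
        (fun a _ => Finset.sum_nonneg fun b _ => hd0 a b) (Finset.mem_univ x)
    linarith
  obtain ⟨n0, hn0⟩ := aux_code hP hVc _ rfl ε (ε / dm) hε (div_pos hε hdm0)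
  obtain ⟨xh0⟩ := ‹Nonempty Xh›
  have hcodes : ∀ n, ∃ C : Code X Y Xh n, max n0 1 ≤ n →
      Real.logb 2 (C.M : ℝ) / (n : ℝ) ≤
        mutInf (fun p : (Y → Xh) × X => P p.2 * V p.2 p.1) + ε ∧
      ∀ Wn : (Fin n → X) → (Fin n → Y) → ℝ, IsChannel Wn → avgSideDist P e Wn ≤ E →
        C.expDist P d Wn ≤ D + ε := by
    intro n
    by_cases hn : max n0 1 ≤ n
    swap
    · exact ⟨⟨1, one_pos, fun _ _ => 1, fun _ => ⟨fun _ => zero_le_one, by simp⟩,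
        fun _ _ _ => xh0⟩, fun h => absurd h hn⟩
    have hn1 : 0 < n := lt_of_lt_of_le one_pos ((le_max_right _ _).trans hn)
    have hnr : (0:ℝ) < n := by exact_mod_cast hn1
    obtain ⟨M, hM, hrate, cb, enc, henc, hcb⟩ := hn0 n ((le_max_left _ _).trans hn)
    refine ⟨⟨M, hM, enc, henc, fun m ys t => cb m t (ys t)⟩, fun _ => ⟨hrate, ?_⟩⟩
    intro Wn hWn hE
    have hPn := aux_isDist_iid hP n
    obtain ⟨W, hW, hWF⟩ := aux_Wbar hP hn1 hWn
    have hWE : W ∈ W1 P e E := ⟨hW, by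
      unfold eDist; rw [← hWF]; exact hE⟩
    have hD := hVD W hWE
    set F : X → Y → ℝ := fun x y => ∑ u : Y → Xh, V x u * d x (u y) with hF
    have hdV : dVW P d V W = ∑ x, ∑ y, P x * W x y * F x y := by
      unfold dVW
      rw [Finset.sum_comm]
      refine Finset.sum_congr rfl fun x _ => ?_
      rw [Finset.sum_comm]
      refine Finset.sum_congr rfl fun y _ => ?_
      rw [hF, Finset.mul_sum]
      refine Finset.sum_congr rfl fun u _ => ?_
      ring
    set Δ : (Fin n → X) → ℝ := fun xs =>
      (∑ t, ∑ a, max 0 (∑ m, enc xs m * ind (cb m t = a) - V (xs t) a)) / n with hΔ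
    have hpt : ∀ xs ys, ∑ m, enc xs m * dseq d n xs (fun t => cb m t (ys t)) ≤
        dseq F n xs ys + dm * Δ xs := by
      intro xs ys
      have e1 : ∑ m, enc xs m * dseq d n xs (fun t => cb m t (ys t)) =
          (∑ t, ∑ a, (∑ m, enc xs m * ind (cb m t = a)) * d (xs t) (a (ys t))) / n := by
        unfold dseq
        simp_rw [mul_div_assoc', ← Finset.sum_div, Finset.mul_sum]
        congr 1
        rw [Finset.sum_comm]
        refine Finset.sum_congr rfl fun t _ => ?_
        simp_rw [Finset.sum_mul]
        rw [Finset.sum_comm]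
        refine Finset.sum_congr rfl fun m _ => ?_
        simp_rw [mul_assoc, ← Finset.mul_sum]
        rw [aux_sum_ind (cb m t) (fun a => d (xs t) (a (ys t)))]
      rw [e1]
      simp only [hΔ, dseq]
      rw [mul_div_assoc', ← add_div, div_le_div_iff_of_pos_right hnr, Finset.mul_sum,
        ← Finset.sum_add_distrib]
      refine Finset.sum_le_sum fun t _ => ?_
      rw [hF, Finset.mul_sum, ← Finset.sum_add_distrib]
      refine Finset.sum_le_sum fun a _ => ?_
      set q := ∑ m, enc xs m * ind (cb m t = a)
      have h1 : q - V (xs t) a ≤ max 0 (q - V (xs t) a) := le_max_right _ _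
      have h2 : 0 ≤ max 0 (q - V (xs t) a) := le_max_left _ _
      have h3 := hdle (xs t) (a (ys t))
      have h4 := hd0 (xs t) (a (ys t))
      nlinarith [mul_le_mul_of_nonneg_right h1 h4, mul_le_mul_of_nonneg_left h3 h2]
    calc Code.expDist (⟨M, hM, enc, henc, fun m ys t => cb m t (ys t)⟩ : Code X Y Xh n) P d Wn
        = ∑ xs, ∑ ys, iid P n xs * Wn xs ys *
            ∑ m, enc xs m * dseq d n xs (fun t => cb m t (ys t)) := by
          unfold Code.expDist
          refine Finset.sum_congr rfl fun xs _ => Finset.sum_congr rfl fun ys _ => ?_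
          rw [Finset.mul_sum]
          refine Finset.sum_congr rfl fun m _ => ?_
          ring
      _ ≤ ∑ xs, ∑ ys, iid P n xs * Wn xs ys * (dseq F n xs ys + dm * Δ xs) :=
          Finset.sum_le_sum fun xs _ => Finset.sum_le_sum fun ys _ =>
            mul_le_mul_of_nonneg_left (hpt xs ys) (mul_nonneg (hPn.1 _) ((hWn _).1 _))
      _ = dVW P d V W + dm * ∑ xs, iid P n xs * Δ xs := by
          rw [hdV, ← hWF, Finset.mul_sum, ← Finset.sum_add_distrib]
          refine Finset.sum_congr rfl fun xs _ => ?_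
          simp_rw [mul_add, Finset.sum_add_distrib, ← Finset.sum_mul, ← Finset.mul_sum,
            (hWn xs).2]
          ring
      _ ≤ D + dm * (ε / dm) := by
          have := mul_le_mul_of_nonneg_left hcb hdm0.le
          linarith
      _ = D + ε := by field_simp
  choose C hC using hcodes
  refine ⟨max n0 1, C, fun n hn => ⟨(hC n hn).1, fun Wseq hW => ?_⟩⟩
  exact (hC n hn).2 (Wseq n) (hW.1 n) (hW.2 n (le_trans (le_max_right _ _) hn))

/-- Direct bound for the average distortion class:
`R_a(D|E) ≤ min_{V ∈ 𝒱(E,D)} I(P_X, V)`, where `I(P_X,V) = I(U;X)` is the mutual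
information between the source letter `X ~ P_X` and the test-channel output `U ~ V(·|X)`. -/
theorem Ra_direct
    {X Y Xh : Type*} [Fintype X] [Fintype Y] [Fintype Xh] [DecidableEq Y]
    [Nonempty X] [Nonempty Y] [Nonempty Xh]
    (P : X → ℝ) (hP : IsDist P)
    (e : X → Y → ℝ) (he0 : ∀ x y, 0 ≤ e x y) (heZ : ∀ x, ∃ y, e x y = 0)
    (d : X → Xh → ℝ) (hd0 : ∀ x xh, 0 ≤ d x xh) (hdZ : ∀ x, ∃ xh, d x xh = 0)
    (D E : ℝ) (hD : 0 ≤ D) (hE : 0 ≤ E) :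
    Ra P e d D E ≤
      sInf ((fun V : X → (Y → Xh) → ℝ =>
        mutInf (fun p : (Y → Xh) × X => P p.2 * V p.2 p.1)) '' Vrob P e d E D) := by
  refine le_csInf ?_ ?_
  · choose z hz using hdZ
    refine Set.Nonempty.image _ ⟨fun x u => ind ((fun _ => z x) = u), fun x => ⟨fun u =>
      aux_ind_nonneg _, ?_⟩, fun W _ => ?_⟩
    · have := aux_sum_ind (fun _ : Y => z x) (fun _ => (1:ℝ))
      simpa using this
    · refine le_trans (le_of_eq ?_) hD
      unfold dVW
      refine Finset.sum_eq_zero fun u _ => Finset.sum_eq_zero fun x _ =>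
        Finset.sum_eq_zero fun y _ => ?_
      by_cases h : (fun _ => z x) = u
      · rw [← h, hz]; ring
      · simp only [aux_ind_false h]; ring
  · rintro _ ⟨V, hV, rfl⟩
    refine csInf_le ⟨-1, ?_⟩ (aux_achievable P hP e d hd0 D E V hV)
    intro R hR
    obtain ⟨n0, C, hC⟩ := hR 1 one_pos
    have h1 := (hC n0 le_rfl).1
    have h2 : 0 ≤ Real.logb 2 ((C n0).M : ℝ) / (n0 : ℝ) := by
      refine div_nonneg (Real.logb_nonneg (by norm_num) ?_) (Nat.cast_nonneg _)
      exact_mod_cast (C n0).Mpos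
    linarith

end UWZ
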